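/- For all real numbers s, t, every n ≥ 1, and all σ ≤ π in OP_n, one has ∑_{ρ: σ ≤ ρ ≤ π} β_s(σ,ρ) β_t(ρ,π) = β_{st}(σ,π); that is, the family (β_t)_{t∈ℝ} forms a semigroup under convolution on the poset of ordered set partitions. -/

import Mathlib

open Finset

namespace OSPpaper

/-- A *block* is a subset of `[n] = Fin n`. -/
abbrev Block (n : ℕ) := Finset (Fin n)

/-- `l` is an ordered set partition of the ground set `E ⊆ [n]`:
a finite sequence of pairwise disjoint nonempty subsets of `E` whose union is `E`. -/
def IsOSP {n : ℕ} (E : Finset (Fin n)) (l : List (Block n)) : Prop :=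
  (∀ P ∈ l, P.Nonempty) ∧ l.Pairwise (fun P Q => Disjoint P Q) ∧
    (∀ P ∈ l, P ⊆ E) ∧ ∀ i ∈ E, ∃ P ∈ l, i ∈ P

/-- Union of a list of blocks. -/
def unionList {n : ℕ} (l : List (Block n)) : Block n := l.foldr (· ∪ ·) ∅

/-- The order on ordered set partitions: `π ≤ σ` iff every block of `σ` is the union
of a contiguous run of blocks of `π` (runs taken in order). -/
def OSPle {n : ℕ} (π σ : List (Block n)) : Prop :=
  ∃ L : List (List (Block n)), L.flatten = π ∧ σ = L.map unionList

/-- The restriction `σ⌋_P`: intersect every block with `P` and delete the empty intersections. -/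
def restrict {n : ℕ} (σ : List (Block n)) (P : Block n) : List (Block n) :=
  (σ.map (fun Q => Q ∩ P)).filter (fun Q => decide (Q ≠ ∅))

/-- The quasi-meet `π ⋏ σ`: the concatenation `σ⌋_{P₁} σ⌋_{P₂} ⋯ σ⌋_{P_p}`. -/
def qmeet {n : ℕ} (π σ : List (Block n)) : List (Block n) :=
  (π.map (fun P => restrict σ P)).flatten

/-- Refinement: every block of `σ` is contained in some block of `τ`.
(As a relation on the underlying unordered partitions, this is the refinement order;
in particular `refines τ η` says `τ̄ ≤ η̄`.) -/
def refines {n : ℕ} (σ τ : List (Block n)) : Prop := ∀ P ∈ σ, ∃ Q ∈ τ, P ⊆ Q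

/-- An interval partition of `[m]`, with its blocks listed in (the unique) increasing order:
an ordered set partition whose consecutive blocks are completely ordered. -/
def IsIP {m : ℕ} (l : List (Finset (Fin m))) : Prop :=
  IsOSP Finset.univ l ∧ l.Chain' (fun P Q => ∀ a ∈ P, ∀ b ∈ Q, a < b)

/-- The (0-based) index `π(k)` of the block of `π` containing `k`. -/
def blockIdx {n : ℕ} (π : List (Block n)) (k : Fin n) : ℕ :=
  π.findIdx (fun P => decide (k ∈ P))

/-- The ordered kernel `κ(i₁,…,iₙ)` of a tuple: the nonempty level sets of the tuple,
listed in increasing order of the value. -/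
def kernel {n : ℕ} (i : Fin n → ℕ) : List (Block n) :=
  ((Finset.image i Finset.univ).sort (· ≤ ·)).map
    (fun v => Finset.univ.filter (fun k => i k = v))

/-- `[σ:π] = ∏_{P ∈ π} #(σ⌋_P)`. -/
def colonNum {n : ℕ} (σ π : List (Block n)) : ℕ :=
  (π.map (fun P => (restrict σ P).length)).prod

/-- `[σ:π]! = ∏_{P ∈ π} #(σ⌋_P)!`. -/
def colonFac {n : ℕ} (σ π : List (Block n)) : ℕ :=
  (π.map (fun P => Nat.factorial (restrict σ P).length)).prod

/-- For `τ̄ ≤ η̄` the sequence `(m_1,…,m_s)`: `m_i` is the (0-based) index of the block of `η`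
containing the `i`-th block of `τ`. -/
def mseq {n : ℕ} (τ η : List (Block n)) : List ℕ :=
  τ.map (fun T => η.findIdx (fun E => decide (T ⊆ E)))

/-- number of ascents of a sequence -/
def ascL (l : List ℕ) : ℕ := ((l.zip l.tail).filter (fun p => decide (p.1 < p.2))).length
/-- number of descents of a sequence -/
def desL (l : List ℕ) : ℕ := ((l.zip l.tail).filter (fun p => decide (p.2 < p.1))).length
/-- number of plateaux of a sequence -/
def platL (l : List ℕ) : ℕ := ((l.zip l.tail).filter (fun p => decide (p.1 = p.2))).length

/-- `asc_η(τ)` -/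
def ascN {n : ℕ} (τ η : List (Block n)) : ℕ := ascL (mseq τ η)
/-- `des_η(τ)` -/
def desN {n : ℕ} (τ η : List (Block n)) : ℕ := desL (mseq τ η)
/-- `plat_η(τ)` -/
def platN {n : ℕ} (τ η : List (Block n)) : ℕ := platL (mseq τ η)

/-- lengths of the maximal ascending runs of a sequence -/
def ascRunLengths (l : List ℕ) : List ℕ :=
  (l.splitBy (fun a b => decide (a < b))).map List.length
/-- lengths of the maximal level (constant) runs of a sequence -/
def levelRunLengths (l : List ℕ) : List ℕ :=
  (l.splitBy (fun a b => decide (a = b))).map List.length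

/-- `μ̃(σ,π) = (−1)^{|σ|−|π|} / [σ:π]` (real-valued). -/
noncomputable def muR {n : ℕ} (σ π : List (Block n)) : ℝ :=
  (-1 : ℝ) ^ (σ.length - π.length) / (colonNum σ π : ℝ)

/-- `ζ̃(σ,π) = 1 / [σ:π]!` (real-valued). -/
noncomputable def zetaR {n : ℕ} (σ π : List (Block n)) : ℝ :=
  1 / (colonFac σ π : ℝ)

/-- The Weisner coefficient `w(τ,η) = ∑_{σ ⋏ η = τ} μ̃(σ, 1̂ₙ)`. -/
noncomputable def wcoef {n : ℕ} (τ η : List (Block n)) : ℝ :=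
  ∑ᶠ σ ∈ {σ : List (Block n) | IsOSP Finset.univ σ ∧ qmeet σ η = τ},
    muR σ [(Finset.univ : Block n)]

/-- The Goldberg coefficient `g(τ,η) = ∑_{σ ≥ τ} ζ̃(τ,σ) w(σ,η)`. -/
noncomputable def gcoef {n : ℕ} (τ η : List (Block n)) : ℝ :=
  ∑ᶠ σ ∈ {σ : List (Block n) | IsOSP Finset.univ σ ∧ OSPle τ σ}, zetaR τ σ * wcoef σ η


/-- The generalized binomial coefficient `C(t,k) = t(t−1)⋯(t−k+1)/k!` for real `t`. -/
noncomputable def gchoose (t : ℝ) (k : ℕ) : ℝ :=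
  (∏ i ∈ Finset.range k, (t - i)) / (Nat.factorial k : ℝ)

/-- `β_t(σ,π) = ∏_{P∈π} C(t, #(σ⌋_P))`. -/
noncomputable def betaF {n : ℕ} (t : ℝ) (σ π : List (Block n)) : ℝ :=
  (π.map (fun P => gchoose t ((restrict σ P).length))).prod

/-! ### The binomial identity summed over splittings of a list -/

lemma gchoose_eq_choose (t : ℝ) (k : ℕ) : gchoose t k = Ring.choose t k := by
  rw [Ring.choose_eq_smul, ← Polynomial.aeval_eq_smeval, Polynomial.aeval_def,
    Polynomial.eval₂_eq_eval_map, descPochhammer_map, descPochhammer_eval_eq_prod_range,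
    gchoose, smul_eq_mul, div_eq_inv_mul]

/-- The generalized binomial coefficient `C(t,k)` as a polynomial in `t`. -/
noncomputable def gchoosePoly (k : ℕ) : Polynomial ℝ :=
  Polynomial.C ((k.factorial : ℝ)⁻¹) * descPochhammer ℝ k

lemma gchoosePoly_eval (t : ℝ) (k : ℕ) : (gchoosePoly k).eval t = gchoose t k := by
  rw [gchoosePoly, Polynomial.eval_C_mul, descPochhammer_eval_eq_prod_range, gchoose,
    div_eq_inv_mul]

lemma coeff_binomialSeries_sub_one (s : ℝ) (k : ℕ) :
    PowerSeries.coeff k (PowerSeries.binomialSeries ℝ s - 1) =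
      if k = 0 then 0 else gchoose s k := by
  rw [map_sub, PowerSeries.binomialSeries_coeff, PowerSeries.coeff_one, gchoose_eq_choose]
  split_ifs with h
  · simp [h]
  · simp

lemma coeff_binomialSeries_sub_one_pow (s : ℝ) {n m : ℕ} (h : n < m) :
    PowerSeries.coeff n ((PowerSeries.binomialSeries ℝ s - 1) ^ m) = 0 := by
  have hX : (PowerSeries.X : PowerSeries ℝ) ∣ PowerSeries.binomialSeries ℝ s - 1 := by
    simp [PowerSeries.X_dvd_iff]
  exact PowerSeries.X_pow_dvd_iff.1 (pow_dvd_pow_of_dvd hX m) n h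

lemma binomialSeries_nat_mul (s : ℝ) (N : ℕ) :
    PowerSeries.binomialSeries ℝ (s * N) = PowerSeries.binomialSeries ℝ s ^ N := by
  induction N with
  | zero => simp
  | succ N ih => rw [Nat.cast_succ, mul_add, mul_one, PowerSeries.binomialSeries_add, ih, pow_succ]

lemma sum_natCast_gchoose_mul_coeff (s : ℝ) (N n : ℕ) :
    ∑ m ∈ range (n + 1), gchoose N m *
        PowerSeries.coeff n ((PowerSeries.binomialSeries ℝ s - 1) ^ m) = gchoose (s * N) n := by
  have hB : gchoose (s * N) n =
      PowerSeries.coeff n ((PowerSeries.binomialSeries ℝ s - 1 + 1) ^ N) := by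
    rw [sub_add_cancel, ← binomialSeries_nat_mul, PowerSeries.binomialSeries_coeff,
      gchoose_eq_choose, smul_eq_mul, mul_one]
  rw [hB, add_pow, map_sum]
  have hterm : ∀ m, PowerSeries.coeff n ((PowerSeries.binomialSeries ℝ s - 1) ^ m *
      1 ^ (N - m) * (N.choose m : PowerSeries ℝ)) = gchoose N m *
        PowerSeries.coeff n ((PowerSeries.binomialSeries ℝ s - 1) ^ m) := by
    intro m
    rw [one_pow, mul_one, gchoose_eq_choose, Ring.choose_natCast, mul_comm, ← nsmul_eq_mul,
      map_nsmul, nsmul_eq_mul]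
  simp only [hterm]
  have extend : ∀ a b : ℕ, (∀ m, a < m → gchoose N m *
        PowerSeries.coeff n ((PowerSeries.binomialSeries ℝ s - 1) ^ m) = 0) →
      ∑ m ∈ range (a + 1), gchoose N m *
        PowerSeries.coeff n ((PowerSeries.binomialSeries ℝ s - 1) ^ m) =
      ∑ m ∈ range (a + b + 1), gchoose N m *
        PowerSeries.coeff n ((PowerSeries.binomialSeries ℝ s - 1) ^ m) := by
    intro a b h
    refine Finset.sum_subset (fun x hx => ?_) fun m _ hm => h m ?_
    · simp only [Finset.mem_range] at hx ⊢; omega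
    · simp only [Finset.mem_range] at hm; omega
  rw [extend n N fun m hm => by rw [coeff_binomialSeries_sub_one_pow s hm, mul_zero],
    extend N n fun m hm => by
      rw [gchoose_eq_choose, Ring.choose_natCast, Nat.choose_eq_zero_of_lt hm, Nat.cast_zero,
        zero_mul], add_comm n N]

/-- The coefficient of `X ^ n` in `((1 + X) ^ s) ^ t = (1 + X) ^ (s * t)`. -/
lemma sum_gchoose_mul_coeff (s t : ℝ) (n : ℕ) :
    ∑ m ∈ range (n + 1), gchoose t m *
        PowerSeries.coeff n ((PowerSeries.binomialSeries ℝ s - 1) ^ m) = gchoose (s * t) n := by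
  have key : ∑ m ∈ range (n + 1), gchoosePoly m * Polynomial.C
        (PowerSeries.coeff n ((PowerSeries.binomialSeries ℝ s - 1) ^ m)) =
      (gchoosePoly n).comp (Polynomial.C s * Polynomial.X) := by
    refine Polynomial.eq_of_infinite_eval_eq _ _
      ((Set.infinite_range_of_injective (Nat.cast_injective (R := ℝ))).mono ?_)
    rintro _ ⟨N, rfl⟩
    simpa [Polynomial.eval_finsetSum, gchoosePoly_eval] using sum_natCast_gchoose_mul_coeff s N n
  simpa [Polynomial.eval_finsetSum, gchoosePoly_eval] using congrArg (Polynomial.eval t) key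

section Splittings

variable {α : Type*}

open Classical in
/-- All ways to write `l` as the concatenation of `m` (possibly empty) lists. -/
noncomputable def splitsInto : ℕ → List α → Finset (List (List α))
  | 0, l => if l = [] then {[]} else ∅
  | m + 1, l => (range (l.length + 1)).biUnion fun i =>
      (splitsInto m (l.drop i)).image fun M => l.take i :: M

lemma mem_splitsInto {m : ℕ} {l : List α} {M : List (List α)} :
    M ∈ splitsInto m l ↔ M.length = m ∧ M.flatten = l := by
  induction m generalizing l M with
  | zero =>
    by_cases h : l = []
    · simp only [splitsInto, if_pos h, Finset.mem_singleton, List.length_eq_zero_iff]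
      constructor
      · rintro rfl; simp [h]
      · exact fun h => h.1
    · simp only [splitsInto, if_neg h, Finset.notMem_empty, List.length_eq_zero_iff, false_iff]
      rintro ⟨rfl, h'⟩
      exact h (by simpa using h'.symm)
  | succ m ih =>
    simp only [splitsInto, Finset.mem_biUnion, Finset.mem_range, Finset.mem_image, ih]
    constructor
    · rintro ⟨i, -, M, ⟨h1, h2⟩, rfl⟩
      simp [h1, h2]
    · rintro ⟨h1, h2⟩
      obtain _ | ⟨p, M⟩ := M
      · simp at h1
      · subst h2
        exact ⟨p.length, by simp, M, ⟨by simpa using h1, by simp⟩, by simp⟩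

lemma sum_splitsInto (f : PowerSeries ℝ) (m : ℕ) (l : List α) :
    ∑ M ∈ splitsInto m l, (M.map fun p => PowerSeries.coeff p.length f).prod =
      PowerSeries.coeff l.length (f ^ m) := by
  classical
  induction m generalizing l with
  | zero =>
    by_cases h : l = [] <;> simp [splitsInto, h, PowerSeries.coeff_one]
  | succ m ih =>
    rw [splitsInto, Finset.sum_biUnion, pow_succ', PowerSeries.coeff_mul,
      Finset.Nat.sum_antidiagonal_eq_sum_range_succ_mk]
    · refine Finset.sum_congr rfl fun i hi => ?_
      have hi' : i ≤ l.length := by simpa [Nat.lt_succ_iff] using hi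
      rw [Finset.sum_image (fun _ _ _ _ h => (List.cons.inj h).2)]
      simp only [List.map_cons, List.prod_cons, ← Finset.mul_sum, ih, List.length_take,
        List.length_drop, min_eq_left hi']
    · intro i hi j hj hij
      simp only [Finset.coe_range, Set.mem_Iio] at hi hj
      refine Finset.disjoint_left.2 fun M hM hM' => hij ?_
      obtain ⟨A, -, rfl⟩ := Finset.mem_image.1 hM
      obtain ⟨B, -, hB⟩ := Finset.mem_image.1 hM'
      have := congrArg List.length (List.cons.inj hB).1
      simp only [List.length_take] at this
      omega

lemma length_le_length_flatten {M : List (List α)} (h : [] ∉ M) :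
    M.length ≤ M.flatten.length := by
  induction M with
  | nil => simp
  | cons p M ih =>
    simp only [List.mem_cons, not_or] at h
    have := ih h.2
    have := List.length_pos_iff.2 (Ne.symm h.1)
    simp only [List.length_cons, List.flatten_cons, List.length_append]
    omega

/-- The weights `C(t, #M) ∏ C(s, #p)` of the splittings of `l` into nonempty parts
sum to `C(st, #l)`. -/
lemma exists_sum_splits (s t : ℝ) (l : List α) :
    ∃ S : Finset (List (List α)), (∀ M, M ∈ S ↔ M.flatten = l ∧ [] ∉ M) ∧
      ∑ M ∈ S, gchoose t M.length * (M.map fun p => gchoose s p.length).prod =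
        gchoose (s * t) l.length := by
  classical
  let S := (range (l.length + 1)).biUnion fun m => splitsInto m l
  refine ⟨S.filter fun M => [] ∉ M, fun M => ?_, ?_⟩
  · simp only [S, Finset.mem_filter, Finset.mem_biUnion, Finset.mem_range, mem_splitsInto]
    constructor
    · rintro ⟨⟨m, -, -, h⟩, h'⟩
      exact ⟨h, h'⟩
    · rintro ⟨rfl, h⟩
      exact ⟨⟨_, Nat.lt_succ_of_le (length_le_length_flatten h), rfl, rfl⟩, h⟩
  · set f : PowerSeries ℝ := PowerSeries.binomialSeries ℝ s - 1 with hf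
    have hw : ∀ M : List (List α), (M.map fun p => PowerSeries.coeff p.length f).prod =
        if ([] : List α) ∉ M then (M.map fun p => gchoose s p.length).prod else 0 := by
      intro M
      by_cases h : [] ∈ M
      · rw [if_neg (not_not.2 h)]
        refine List.prod_eq_zero (List.mem_map.2 ⟨[], h, ?_⟩)
        rw [hf, coeff_binomialSeries_sub_one, List.length_nil, if_pos rfl]
      · rw [if_pos h]
        refine congrArg List.prod (List.map_congr_left fun p hp => ?_)
        rw [hf, coeff_binomialSeries_sub_one, if_neg]
        rw [List.length_eq_zero_iff]
        rintro rfl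
        exact h hp
    rw [Finset.sum_filter, ← sum_gchoose_mul_coeff]
    simp only [← mul_ite_zero, ← hw]
    rw [Finset.sum_biUnion]
    · refine Finset.sum_congr rfl fun m _ => ?_
      rw [← sum_splitsInto, Finset.mul_sum]
      exact Finset.sum_congr rfl fun M hM => by rw [(mem_splitsInto.1 hM).1]
    · intro i _ j _ hij
      refine Finset.disjoint_left.2 fun M hM hM' => hij ?_
      rw [← (mem_splitsInto.1 hM).1, (mem_splitsInto.1 hM').1]

/-- Simultaneous version of `exists_sum_splits` for all members of a list of lists. -/
lemma exists_sum_multisplits (s t : ℝ) (L : List (List α)) :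
    ∃ S : Finset (List (List (List α))),
      (∀ K, K ∈ S ↔ K.map List.flatten = L ∧ ∀ M ∈ K, [] ∉ M) ∧
      ∑ K ∈ S, (K.map fun M =>
          gchoose t M.length * (M.map fun p => gchoose s p.length).prod).prod =
        (L.map fun l => gchoose (s * t) l.length).prod := by
  classical
  induction L with
  | nil =>
    refine ⟨{[]}, fun K => ?_, by simp⟩
    rw [Finset.mem_singleton, List.map_eq_nil_iff]
    constructor
    · rintro rfl; simp
    · exact fun h => h.1
  | cons l L ih =>
    obtain ⟨S, hS, hsum⟩ := ih
    obtain ⟨T, hT, hTsum⟩ := exists_sum_splits s t l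
    refine ⟨(T ×ˢ S).image fun x => x.1 :: x.2, fun K => ?_, ?_⟩
    · simp only [Finset.mem_image, Finset.mem_product, hS, hT, Prod.exists]
      constructor
      · rintro ⟨M, K, ⟨⟨h1, h2⟩, h3, h4⟩, rfl⟩
        simp only [List.map_cons, h1, h3, List.mem_cons, forall_eq_or_imp]
        exact ⟨trivial, h2, h4⟩
      · rintro ⟨h1, h2⟩
        obtain _ | ⟨M, K⟩ := K
        · simp at h1
        · simp only [List.map_cons, List.cons.injEq] at h1
          simp only [List.mem_cons, forall_eq_or_imp] at h2
          exact ⟨M, K, ⟨⟨h1.1, h2.1⟩, h1.2, h2.2⟩, rfl⟩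
    · rw [Finset.sum_image, Finset.sum_product, List.map_cons, List.prod_cons, ← hTsum, ← hsum,
        Finset.sum_mul_sum]
      · simp only [List.map_cons, List.prod_cons]
      · rintro ⟨M, K⟩ _ ⟨M', K'⟩ _ h
        simpa using h

lemma exists_flatten_eq_of_map_eq_flatten {β : Type*} {f : α → β} {A : List α}
    {B : List (List β)} (h : A.map f = B.flatten) :
    ∃ K : List (List α), K.flatten = A ∧ K.map (List.map f) = B := by
  induction B generalizing A with
  | nil => exact ⟨[], by simpa using h.symm, rfl⟩
  | cons b B ih =>
    obtain ⟨A₁, A₂, rfl, h1, h2⟩ := List.map_eq_append_iff.1 h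
    obtain ⟨K, rfl, rfl⟩ := ih h2
    exact ⟨A₁ :: K, rfl, by rw [List.map_cons, h1]⟩

end Splittings

/-! ### Merging contiguous runs of blocks -/

section Blocks

variable {n : ℕ}

lemma mem_unionList {l : List (Block n)} {i : Fin n} : i ∈ unionList l ↔ ∃ P ∈ l, i ∈ P := by
  induction l with
  | nil => simp [unionList]
  | cons P l ih =>
    change i ∈ P ∪ unionList l ↔ _
    rw [Finset.mem_union, ih]
    simp

lemma unionList_append (l l' : List (Block n)) :
    unionList (l ++ l') = unionList l ∪ unionList l' := by
  ext i
  simp only [mem_unionList, Finset.mem_union, List.mem_append]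
  grind

lemma unionList_map_unionList (M : List (List (Block n))) :
    unionList (M.map unionList) = unionList M.flatten := by
  ext i
  simp only [mem_unionList, List.mem_map, List.mem_flatten]
  grind [mem_unionList]

lemma disjoint_unionList {l l' : List (Block n)} (h : ∀ P ∈ l, ∀ Q ∈ l', Disjoint P Q) :
    Disjoint (unionList l) (unionList l') := by
  rw [Finset.disjoint_left]
  intro i hi hi'
  obtain ⟨P, hP, hiP⟩ := mem_unionList.1 hi
  obtain ⟨Q, hQ, hiQ⟩ := mem_unionList.1 hi'
  exact Finset.disjoint_left.1 (h P hP Q hQ) hiP hiQ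

lemma eq_nil_of_unionList_append_eq {l c : List (Block n)} (hne : ∀ P ∈ c, P.Nonempty)
    (hd : ∀ P ∈ l, ∀ Q ∈ c, Disjoint P Q) (h : unionList (l ++ c) = unionList l) : c = [] := by
  by_contra hc
  obtain ⟨Q, hQ⟩ := List.exists_mem_of_ne_nil c hc
  obtain ⟨i, hi⟩ := hne Q hQ
  have hic : i ∈ unionList c := mem_unionList.2 ⟨Q, hQ, hi⟩
  have hil : i ∈ unionList l := by
    rw [← h, unionList_append]
    exact Finset.mem_union_right _ hic
  exact Finset.disjoint_left.1 (disjoint_unionList hd) hil hic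

/-- A division of a list of disjoint nonempty blocks into runs is determined by the unions
of the runs. -/
lemma eq_of_flatten_eq_of_map_unionList_eq {L L' : List (List (Block n))}
    (hne : ∀ P ∈ L.flatten, P.Nonempty) (hd : L.flatten.Pairwise fun P Q => Disjoint P Q)
    (hf : L.flatten = L'.flatten) (hu : L.map unionList = L'.map unionList) : L = L' := by
  induction L generalizing L' with
  | nil => simpa using hu.symm
  | cons l R ih =>
    obtain _ | ⟨l', R'⟩ := L'
    · simp at hu
    have hne' := hne
    have hd' := hd
    rw [hf] at hne' hd'
    simp only [List.map_cons, List.cons.injEq, List.flatten_cons] at hu hf hne hd hne' hd'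
    have hl : l = l' := by
      rcases List.append_eq_append_iff.1 hf with ⟨c, rfl, hc⟩ | ⟨c, rfl, hc⟩
      · rw [eq_nil_of_unionList_append_eq (l := l) (c := c) (fun P hP => hne P (by simp [hc, hP]))
          (fun P hP Q hQ => (List.pairwise_append.1 hd).2.2 P hP Q (by simp [hc, hQ])) hu.1.symm,
          List.append_nil]
      · rw [eq_nil_of_unionList_append_eq (l := l') (c := c) (fun P hP => hne' P (by simp [hc, hP]))
          (fun P hP Q hQ => (List.pairwise_append.1 hd').2.2 P hP Q (by simp [hc, hQ])) hu.1,
          List.append_nil]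
    subst hl
    rw [ih (fun P hP => hne P (List.mem_append_right _ hP)) (List.pairwise_append.1 hd).2.1
      (List.append_cancel_left hf) hu.2]

lemma IsOSP.map_unionList {E : Finset (Fin n)} {L : List (List (Block n))}
    (h : IsOSP E L.flatten) (hL : [] ∉ L) : IsOSP E (L.map unionList) := by
  obtain ⟨h1, h2, h3, h4⟩ := h
  refine ⟨?_, ?_, ?_, ?_⟩
  · intro P hP
    obtain ⟨l, hl, rfl⟩ := List.mem_map.1 hP
    obtain ⟨Q, hQ⟩ := List.exists_mem_of_ne_nil l (fun h => hL (h ▸ hl))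
    obtain ⟨i, hi⟩ := h1 Q (List.mem_flatten.2 ⟨l, hl, hQ⟩)
    exact ⟨i, mem_unionList.2 ⟨Q, hQ, hi⟩⟩
  · rw [List.pairwise_map]
    exact (List.pairwise_flatten.1 h2).2.imp disjoint_unionList
  · intro P hP i hi
    obtain ⟨l, hl, rfl⟩ := List.mem_map.1 hP
    obtain ⟨Q, hQ, hiQ⟩ := mem_unionList.1 hi
    exact h3 Q (List.mem_flatten.2 ⟨l, hl, hQ⟩) hiQ
  · intro i hi
    obtain ⟨Q, hQ, hiQ⟩ := h4 i hi
    obtain ⟨l, hl, hQl⟩ := List.mem_flatten.1 hQ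
    exact ⟨unionList l, List.mem_map_of_mem hl, mem_unionList.2 ⟨Q, hQl, hiQ⟩⟩

lemma IsOSP.nil_notMem {E : Finset (Fin n)} {L : List (List (Block n))}
    (h : IsOSP E (L.map unionList)) : [] ∉ L := fun hL => by
  obtain ⟨i, hi⟩ := h.1 _ (List.mem_map_of_mem hL)
  simp [mem_unionList] at hi

lemma restrict_append (l l' : List (Block n)) (P : Block n) :
    restrict (l ++ l') P = restrict l P ++ restrict l' P := by
  simp [restrict]

lemma restrict_eq_nil {l : List (Block n)} {P : Block n} (h : ∀ Q ∈ l, Disjoint Q P) :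
    restrict l P = [] := by
  simp only [restrict, List.filter_eq_nil_iff, List.mem_map]
  rintro _ ⟨Q, hQ, rfl⟩
  simpa [Finset.disjoint_iff_inter_eq_empty] using h Q hQ

lemma restrict_unionList_self {l : List (Block n)} (h : ∀ P ∈ l, P.Nonempty) :
    restrict l (unionList l) = l := by
  have hmap : l.map (fun Q => Q ∩ unionList l) = l := by
    refine (List.map_congr_left fun Q hQ => ?_).trans l.map_id
    exact Finset.inter_eq_left.2 fun i hi => mem_unionList.2 ⟨Q, hQ, hi⟩
  rw [restrict, hmap, List.filter_eq_self]
  intro P hP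
  simpa using (h P hP).ne_empty

lemma restrict_flatten {L : List (List (Block n))} (hne : ∀ P ∈ L.flatten, P.Nonempty)
    (hd : L.flatten.Pairwise fun P Q => Disjoint P Q) {l : List (Block n)} (hl : l ∈ L) :
    restrict L.flatten (unionList l) = l := by
  obtain ⟨A, B, rfl⟩ := List.append_of_mem hl
  simp only [List.flatten_append, List.flatten_cons] at hne hd ⊢
  obtain ⟨-, hd2, hd3⟩ := List.pairwise_append.1 hd
  have hA : restrict A.flatten (unionList l) = [] := by
    refine restrict_eq_nil fun Q hQ => ?_
    simpa [unionList] using disjoint_unionList (l := [Q]) (l' := l) fun P hP R hR => by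
      rw [List.mem_singleton.1 hP]
      exact hd3 Q hQ R (List.mem_append_left _ hR)
  have hB : restrict B.flatten (unionList l) = [] := by
    refine restrict_eq_nil fun Q hQ => ?_
    simpa [unionList] using disjoint_unionList (l := [Q]) (l' := l) fun P hP R hR => by
      rw [List.mem_singleton.1 hP]
      exact ((List.pairwise_append.1 hd2).2.2 R hR Q hQ).symm
  rw [restrict_append, restrict_append, hA, hB, List.append_nil, List.nil_append,
    restrict_unionList_self fun P hP => hne P (by simp [hP])]

lemma betaF_flatten_map_unionList (t : ℝ) {E : Finset (Fin n)} {L : List (List (Block n))}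
    (h : IsOSP E L.flatten) :
    betaF t L.flatten (L.map unionList) = (L.map fun l => gchoose t l.length).prod := by
  rw [betaF, List.map_map]
  refine congrArg List.prod (List.map_congr_left fun l hl => ?_)
  rw [Function.comp_apply, restrict_flatten h.1 h.2.1 hl]

end Blocks

/-- For all real `s, t`, every `n ≥ 1` and all `σ ≤ π` in `OP_n`,
`∑_{σ ≤ ρ ≤ π} β_s(σ,ρ) β_t(ρ,π) = β_{st}(σ,π)`: the family `(β_t)` is a semigroup under
convolution on the poset of ordered set partitions. -/
theorem statement7 (s t : ℝ) {n : ℕ} (hn : 1 ≤ n) (σ π : List (Block n))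
    (hσ : IsOSP Finset.univ σ) (hπ : IsOSP Finset.univ π) (h : OSPle σ π) :
    (∑ᶠ ρ ∈ {ρ : List (Block n) | IsOSP Finset.univ ρ ∧ OSPle σ ρ ∧ OSPle ρ π},
        betaF s σ ρ * betaF t ρ π) = betaF (s * t) σ π := by
  obtain ⟨L, rfl, rfl⟩ := h
  obtain ⟨S, hS, hsum⟩ := exists_sum_multisplits s t L
  have hflat : ∀ K ∈ S, K.flatten.flatten = L.flatten := fun K hK => by
    rw [List.flatten_flatten, ((hS K).1 hK).1]
  have hOSP : ∀ K ∈ S, IsOSP Finset.univ (K.flatten.map unionList) := fun K hK => by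
    refine IsOSP.map_unionList (by rwa [hflat K hK]) fun hnil => ?_
    obtain ⟨M, hM, hM'⟩ := List.mem_flatten.1 hnil
    exact ((hS K).1 hK).2 M hM hM'
  have hcoarse : ∀ K ∈ S, (K.map (List.map unionList)).map unionList = L.map unionList :=
    fun K hK => by
      rw [← ((hS K).1 hK).1, List.map_map, List.map_map]
      exact List.map_congr_left fun M _ => unionList_map_unionList M
  have hset : {ρ : List (Block n) | IsOSP Finset.univ ρ ∧ OSPle L.flatten ρ ∧
      OSPle ρ (L.map unionList)} =
      (fun K : List (List (List (Block n))) => K.flatten.map unionList) ''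
        (S : Set (List (List (List (Block n))))) := by
    ext ρ
    constructor
    · rintro ⟨hρ, ⟨A, hA, rfl⟩, ⟨B, hB, hBL⟩⟩
      obtain ⟨K, rfl, rfl⟩ := exists_flatten_eq_of_map_eq_flatten hB.symm
      refine ⟨K, (hS K).2 ⟨?_, fun M hM hM' => hρ.nil_notMem ?_⟩, rfl⟩
      · refine (eq_of_flatten_eq_of_map_unionList_eq hσ.1 hσ.2.1 ?_ ?_).symm
        · rw [← List.flatten_flatten, hA]
        · rw [hBL, List.map_map, List.map_map]
          exact List.map_congr_left fun M _ => unionList_map_unionList M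
      · exact List.mem_flatten.2 ⟨M, hM, hM'⟩
    · rintro ⟨K, hK, rfl⟩
      exact ⟨hOSP K hK, ⟨K.flatten, hflat K hK, rfl⟩,
        ⟨K.map (List.map unionList), List.map_flatten.symm, (hcoarse K hK).symm⟩⟩
  have hinj : Set.InjOn (fun K : List (List (List (Block n))) => K.flatten.map unionList)
      (S : Set (List (List (List (Block n))))) := by
    intro K hK K' hK' hKK'
    have hσK : IsOSP Finset.univ K.flatten.flatten := by rwa [hflat K hK]
    have h1 : K.flatten = K'.flatten :=
      eq_of_flatten_eq_of_map_unionList_eq hσK.1 hσK.2.1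
        ((hflat K hK).trans (hflat K' hK').symm) hKK'
    have hρK : IsOSP Finset.univ (K.map (List.map unionList)).flatten := by
      rw [← List.map_flatten]
      exact hOSP K hK
    have h2 : K.map (List.map unionList) = K'.map (List.map unionList) :=
      eq_of_flatten_eq_of_map_unionList_eq hρK.1 hρK.2.1
        (by rw [← List.map_flatten, ← List.map_flatten, h1])
        ((hcoarse K hK).trans (hcoarse K' hK').symm)
    refine List.eq_iff_flatten_eq.2 ⟨h1, ?_⟩
    simpa [Function.comp_def] using congrArg (List.map List.length) h2
  rw [hset, finsum_mem_image hinj, finsum_mem_coe_finset, betaF_flatten_map_unionList _ hσ, ← hsum]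
  refine Finset.sum_congr rfl fun K hK => ?_
  have hβs : betaF s L.flatten (K.flatten.map unionList) =
      (K.map fun M => (M.map fun p => gchoose s p.length).prod).prod := by
    rw [← hflat K hK, betaF_flatten_map_unionList s (E := Finset.univ) (by rwa [hflat K hK]),
      List.map_flatten, List.prod_flatten, List.map_map]
    rfl
  have hβt : betaF t (K.flatten.map unionList) (L.map unionList) =
      (K.map fun M => gchoose t M.length).prod := by
    have hρK := hOSP K hK
    rw [List.map_flatten] at hρK ⊢
    rw [← hcoarse K hK, betaF_flatten_map_unionList t hρK, List.map_map]
    simp [Function.comp_def]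
  rw [hβs, hβt, mul_comm, ← List.prod_map_mul]

end OSPpaper
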